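/- arXiv:1407.5082 — 2 statements merged into one kernel-verified Lean document; each statement's English description precedes it below -/
import Mathlib

section
/- For every t ∈ ℝ^{k^m}, the subspace B_m is invariant under T_{t,m}: if Y ∈ D satisfies Y_w = Q_w Y_w Q_w for every word w ∈ {1,…,k}^{m−1}, then [T_{t,m}(Y)]_w = Q_w [T_{t,m}(Y)]_w Q_w for every word w ∈ {1,…,k}^{m−1}. -/
open Matrix Finset

/-- Product `V_{i_n} ⋯ V_{i_1}` of Kraus operators along a word `(i_1, …, i_n)`. -/
noncomputable def prodRev {d k n : ℕ} (V : Fin k → Matrix (Fin d) (Fin d) ℂ)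
    (i : Fin n → Fin k) : Matrix (Fin d) (Fin d) ℂ :=
  ((List.ofFn i).reverse.map V).prod

/-- The extended transition operator `T_{t,m}` (with `m = m' + 1`) acting on families
`Y = (Y_w)_{w ∈ {1,…,k}^{m-1}}` of `d × d` matrices. -/
noncomputable def extT {d k m' : ℕ} (V : Fin k → Matrix (Fin d) (Fin d) ℂ)
    (t : (Fin (m' + 1) → Fin k) → ℝ)
    (Y : (Fin m' → Fin k) → Matrix (Fin d) (Fin d) ℂ) :
    (Fin m' → Fin k) → Matrix (Fin d) (Fin d) ℂ :=
  fun w => ∑ j : Fin k,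
    (Real.exp (t (Fin.snoc w j)) : ℂ) •
      ((V ((Fin.snoc w j : Fin (m' + 1) → Fin k) 0))ᴴ *
        Y (Fin.tail (Fin.snoc w j : Fin (m' + 1) → Fin k)) *
        V ((Fin.snoc w j : Fin (m' + 1) → Fin k) 0))

/-- `M^{(m)}`, with `[M^{(m)}]_{i_1,…,i_{m-1}} = (V_{i_{m-1}} ⋯ V_{i_1})* (V_{i_{m-1}} ⋯ V_{i_1})`. -/
noncomputable def Mmat {d k m' : ℕ} (V : Fin k → Matrix (Fin d) (Fin d) ℂ) :
    (Fin m' → Fin k) → Matrix (Fin d) (Fin d) ℂ :=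
  fun w => (prodRev V w)ᴴ * prodRev V w

lemma prodRev_snoc {d k n : ℕ} (V : Fin k → Matrix (Fin d) (Fin d) ℂ)
    (w : Fin n → Fin k) (j : Fin k) :
    prodRev V (Fin.snoc w j : Fin (n + 1) → Fin k) = V j * prodRev V w := by
  rw [prodRev, List.ofFn_succ']
  simp [prodRev, -List.map_ofFn, -List.map_reverse]

lemma prodRev_eq_tail_mul {d k n : ℕ} (V : Fin k → Matrix (Fin d) (Fin d) ℂ)
    (u : Fin (n + 1) → Fin k) :
    prodRev V u = prodRev V (Fin.tail u) * V (u 0) := by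
  rw [prodRev, List.ofFn_succ, List.reverse_cons, List.map_append, List.prod_append]
  simp only [List.map_cons, List.map_nil, List.prod_singleton]
  rfl

/-- A statement about kernels of vectors extends columnwise to matrices. -/
lemma mul_eq_zero_of_mulVec_ker_le {d : ℕ} {M Q : Matrix (Fin d) (Fin d) ℂ}
    (h : ∀ v : Fin d → ℂ, M *ᵥ v = 0 → Q *ᵥ v = 0) {A : Matrix (Fin d) (Fin d) ℂ}
    (hA : M * A = 0) : Q * A = 0 := by
  refine Matrix.ext_of_mulVec_single fun i => ?_
  rw [← Matrix.mulVec_mulVec, Matrix.zero_mulVec]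
  exact h _ (by rw [Matrix.mulVec_mulVec, hA, Matrix.zero_mulVec])

open scoped ComplexOrder in
/-- The Kraus operator `V_{u_0}` maps the kernel of the projection attached to the initial part of
the word `u` into the kernel of the projection attached to its tail. -/
lemma proj_tail_mul_kraus_mul_proj {d k n : ℕ} (V : Fin k → Matrix (Fin d) (Fin d) ℂ)
    (Q : (Fin n → Fin k) → Matrix (Fin d) (Fin d) ℂ)
    (hQherm : ∀ w, (Q w).IsHermitian)
    (hQrange : ∀ w, Q w * Mmat V w = Mmat V w)
    (hQker : ∀ w (v : Fin d → ℂ), Mmat V w *ᵥ v = 0 → Q w *ᵥ v = 0)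
    (w : Fin n → Fin k) (j : Fin k) (u : Fin (n + 1) → Fin k) (hu : u = Fin.snoc w j) :
    Q (Fin.tail u) * V (u 0) * Q w = Q (Fin.tail u) * V (u 0) := by
  have hM : Mmat V w * (1 - Q w) = 0 := by
    have h := congrArg conjTranspose (hQrange w)
    have hherm : (Mmat V w)ᴴ = Mmat V w := by simp [Mmat]
    rw [conjTranspose_mul, hherm, (hQherm w).eq] at h
    rw [mul_sub, mul_one, h, sub_self]
  have hP : prodRev V w * (1 - Q w) = 0 :=
    (conjTranspose_mul_self_mul_eq_zero _ _).1 hM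
  have hT : Mmat V (Fin.tail u) * (V (u 0) * (1 - Q w)) = 0 := by
    rw [Mmat, mul_assoc, ← mul_assoc (prodRev V (Fin.tail u)), ← prodRev_eq_tail_mul, hu,
      prodRev_snoc, mul_assoc, hP, mul_zero, mul_zero]
  have h := mul_eq_zero_of_mulVec_ker_le (hQker (Fin.tail u)) hT
  rw [mul_sub, mul_one, mul_sub, sub_eq_zero, ← mul_assoc] at h
  exact h.symm

/-- Invariance of `B_m` under `T_{t,m}`: if each block of `Y` is supported on the range of the
corresponding block of `M^{(m)}` (i.e. `Y_w = Q_w Y_w Q_w` for the orthogonal projections `Q_w`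
onto the ranges of the blocks `[M^{(m)}]_w`), then the same holds for `T_{t,m}(Y)`. -/
theorem extT_preserves_B {d k m' : ℕ} (hd : 1 ≤ d) (hk : 1 ≤ k)
    (V : Fin k → Matrix (Fin d) (Fin d) ℂ)
    (hnorm : ∑ i : Fin k, (V i)ᴴ * V i = 1)
    (Q : (Fin m' → Fin k) → Matrix (Fin d) (Fin d) ℂ)
    -- `Q_w` is the orthogonal projection onto the range of `[M^{(m)}]_w`:
    (hQherm : ∀ w, (Q w).IsHermitian)
    (hQidem : ∀ w, Q w * Q w = Q w)
    (hQrange : ∀ w, Q w * Mmat V w = Mmat V w)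
    (hQker : ∀ w (v : Fin d → ℂ), Mmat V w *ᵥ v = 0 → Q w *ᵥ v = 0)
    (t : (Fin (m' + 1) → Fin k) → ℝ)
    (Y : (Fin m' → Fin k) → Matrix (Fin d) (Fin d) ℂ)
    (hY : ∀ w, Y w = Q w * Y w * Q w) :
    ∀ w, extT V t Y w = Q w * extT V t Y w * Q w := by
  intro w
  simp only [extT, Finset.mul_sum, Finset.sum_mul, mul_smul_comm, smul_mul_assoc]
  refine Finset.sum_congr rfl fun j _ => congrArg _ ?_
  generalize hu : (Fin.snoc w j : Fin (m' + 1) → Fin k) = u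
  have h := proj_tail_mul_kraus_mul_proj V Q hQherm hQrange hQker w j u hu.symm
  have h' := congrArg conjTranspose h
  simp only [conjTranspose_mul, (hQherm _).eq] at h'
  calc (V (u 0))ᴴ * Y (Fin.tail u) * V (u 0)
      = ((V (u 0))ᴴ * Q (Fin.tail u)) * Y (Fin.tail u) * (Q (Fin.tail u) * V (u 0)) := by
        conv_lhs => rw [hY (Fin.tail u)]
        simp only [mul_assoc]
    _ = (Q w * ((V (u 0))ᴴ * Q (Fin.tail u))) * Y (Fin.tail u) *
          (Q (Fin.tail u) * V (u 0) * Q w) := by rw [h, h']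
    _ = Q w * ((V (u 0))ᴴ * (Q (Fin.tail u) * Y (Fin.tail u) * Q (Fin.tail u)) * V (u 0)) *
          Q w := by simp only [mul_assoc]
    _ = Q w * ((V (u 0))ᴴ * Y (Fin.tail u) * V (u 0)) * Q w := by rw [← hY]
end

section
/- Suppose the transition operator T is primitive and ψ ∈ ℂ^d is a unit vector. For t ∈ ℝ^{k^m} let Γ_n^{(m)}(t) = E[ exp( ∑_{j=1}^{n−m+1} t_{X^{(j)}, X^{(j+1)}, …, X^{(j+m−1)}} ) ] be the moment generating function of the level-m statistics of the output process. Then lim_{n→∞} (1/n) log Γ_n^{(m)}(t) = log r(T̃_{t,m}), where r(T̃_{t,m}) is the spectral radius of the restriction T̃_{t,m} of T_{t,m} to B_m. -/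
open Matrix Finset
open scoped ComplexOrder

/-- The transition operator `T(A) = ∑ᵢ Vᵢ* A Vᵢ` of the quantum Markov chain. -/
noncomputable def Tmap {d k : ℕ} (V : Fin k → Matrix (Fin d) (Fin d) ℂ)
    (A : Matrix (Fin d) (Fin d) ℂ) : Matrix (Fin d) (Fin d) ℂ :=
  ∑ i : Fin k, (V i)ᴴ * A * V i

/-- Probability `P(X⁽¹⁾ = i₁, …, X⁽ⁿ⁾ = iₙ) = ‖V_{iₙ} ⋯ V_{i₁} ψ‖²` of an output trajectory. -/
noncomputable def outProb {d k n : ℕ} (V : Fin k → Matrix (Fin d) (Fin d) ℂ)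
    (ψ : Fin d → ℂ) (i : Fin n → Fin k) : ℝ :=
  ∑ x : Fin d, ‖(prodRev V i *ᵥ ψ) x‖ ^ 2

/-- The subspace `B_m = { Y : Y_w = Q_w Y_w Q_w for all words w }`. -/
noncomputable def Bsub {d k m' : ℕ} (Q : (Fin m' → Fin k) → Matrix (Fin d) (Fin d) ℂ) :
    Submodule ℂ ((Fin m' → Fin k) → Matrix (Fin d) (Fin d) ℂ) where
  carrier := {Y | ∀ w, Y w = Q w * Y w * Q w}
  add_mem' := by
    intro a b ha hb w
    simp only [Pi.add_apply]
    rw [Matrix.mul_add, Matrix.add_mul, ← ha w, ← hb w]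
  zero_mem' := by intro w; simp
  smul_mem' := by
    intro c a ha w
    simp only [Pi.smul_apply]
    rw [Matrix.mul_smul, Matrix.smul_mul, ← ha w]

/-- The level-`m` moment generating function
`Γₙ⁽ᵐ⁾(t) = E[exp(∑_{j=1}^{n-m+1} t_{X⁽ʲ⁾,…,X⁽ʲ⁺ᵐ⁻¹⁾})]` of the output process
(with `m = m' + 1`, so the number of windows is `n - m + 1 = n - m'`). -/
noncomputable def mgf {d k m' : ℕ} (V : Fin k → Matrix (Fin d) (Fin d) ℂ)
    (ψ : Fin d → ℂ) (t : (Fin (m' + 1) → Fin k) → ℝ) (n : ℕ) : ℝ :=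
  ∑ i : Fin n → Fin k, outProb V ψ i *
    Real.exp (∑ j : Fin (n - m'),
      t (fun l : Fin (m' + 1) => i ⟨j.1 + l.1, by have hj := j.2; have hl := l.2; omega⟩))

theorem Tendsto.shifted_add_div {u : ℕ → ℝ} {L : ℝ}
    (hu : Filter.Tendsto (fun n : ℕ => u n / n) Filter.atTop (nhds L)) (q : ℕ) (C : ℝ) :
    Filter.Tendsto (fun n : ℕ => (u (n - q) + C) / n) Filter.atTop (nhds L) := by
  rw [← Filter.tendsto_add_atTop_iff_nat q]
  have h1 := tendsto_natCast_div_add_atTop (𝕜 := ℝ) (q : ℝ)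
  have h2 : Filter.Tendsto (fun n : ℕ => C / ((n + q : ℕ) : ℝ)) Filter.atTop (nhds 0) :=
    (tendsto_const_div_atTop_nhds_zero_nat C).comp (Filter.tendsto_add_atTop_nat q)
  have h3 := (hu.mul h1).add h2
  rw [mul_one, add_zero] at h3
  refine h3.congr' ?_
  filter_upwards [Filter.eventually_gt_atTop 0] with n hn
  have hn' : (0 : ℝ) < n := by exact_mod_cast hn
  have : (0 : ℝ) < n + q := by positivity
  simp only [Nat.add_sub_cancel]
  push_cast
  field_simp

/-- If the `N`-th term of a positive sequence is comparable, up to constants and bounded index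
shifts, to the size of `S ^ N`, then its exponential growth rate is the spectral radius of `S`. -/
theorem tendsto_log_div_of_comparable_pow {E : Type*} [NormedAddCommGroup E] [NormedSpace ℂ E]
    [FiniteDimensional ℂ E] (S : Module.End ℂ E) (Γ : ℕ → ℝ) (q p : ℕ) {δ : ℝ} (hδ : 0 < δ)
    (hlow : ∀ N, δ ^ N ≤ Γ (q + N))
    (φ : E →ₗ[ℂ] ℂ) (Y₀ : E) (hup : ∀ N, Γ (q + N) ≤ ‖φ ((S ^ N) Y₀)‖)
    (hdom : ∀ Y, ∃ C, ∀ N, ‖(S ^ N) Y‖ ≤ C * Γ (q + (N + p))) :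
    Filter.Tendsto (fun n : ℕ => Real.log (Γ n) / n) Filter.atTop
      (nhds (Real.log ((spectralRadius ℂ S).toReal))) := by
  have : CompleteSpace E := FiniteDimensional.complete ℂ E
  set a : E →L[ℂ] E := Module.End.toContinuousLinearMap E S with ha
  have hpow : ∀ N Y, (a ^ N) Y = (S ^ N) Y := by
    intro N Y
    rw [ha, ← map_pow]
    rfl
  have hΓ : ∀ N, 0 < Γ (q + N) := fun N => (pow_pos hδ N).trans_le (hlow N)
  have hrad : spectralRadius ℂ S = spectralRadius ℂ a := by
    simp only [spectralRadius, ha, AlgEquiv.spectrum_eq]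
  obtain ⟨C₁, hC₁, hup'⟩ : ∃ C > 0, ∀ N, Γ (q + N) ≤ C * ‖a ^ N‖ := by
    let f := LinearMap.toContinuousLinearMap φ
    refine ⟨‖f‖ * ‖Y₀‖ + 1, by positivity, fun N => (hup N).trans ?_⟩
    have h1 : ‖f ((a ^ N) Y₀)‖ ≤ ‖f‖ * (‖a ^ N‖ * ‖Y₀‖) :=
      (f.le_opNorm _).trans (by gcongr; exact (a ^ N).le_opNorm _)
    rw [hpow] at h1
    refine (show ‖φ ((S ^ N) Y₀)‖ ≤ _ from h1).trans ?_
    nlinarith [norm_nonneg (a ^ N)]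
  obtain ⟨C₂, hC₂, hdom'⟩ : ∃ C > 0, ∀ N, ‖a ^ N‖ ≤ C * Γ (q + (N + p)) := by
    obtain ⟨C, hC⟩ := banach_steinhaus
      (g := fun N : ℕ => (((Γ (q + (N + p)))⁻¹ : ℝ) : ℂ) • a ^ N) (by
        intro Y
        obtain ⟨C, hC⟩ := hdom Y
        refine ⟨C, fun N => ?_⟩
        have hpos := hΓ (N + p)
        rw [_root_.smul_apply, norm_smul, hpow, Complex.norm_real, Real.norm_eq_abs,
          abs_of_pos (inv_pos.2 hpos), inv_mul_le_iff₀ hpos, mul_comm]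
        exact hC N)
    refine ⟨|C| + 1, by positivity, fun N => ?_⟩
    have hpos := hΓ (N + p)
    have h1 := hC N
    rw [norm_smul, Complex.norm_real, Real.norm_eq_abs, abs_of_pos (inv_pos.2 hpos),
      inv_mul_le_iff₀ hpos] at h1
    nlinarith [le_abs_self C]
  have hapos : ∀ N, 0 < ‖a ^ N‖ := fun N => by
    have := (hΓ N).trans_le (hup' N)
    exact pos_of_mul_pos_right this hC₁.le
  have hE : Nontrivial E := by
    by_contra h
    rw [not_nontrivial_iff_subsingleton] at h
    exact norm_pos_iff.1 (hapos 0) (ContinuousLinearMap.ext fun x => Subsingleton.elim _ _)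
  have hfin : spectralRadius ℂ a ≠ ⊤ :=
    ((spectrum.spectralRadius_le_nnnorm a).trans_lt ENNReal.coe_lt_top).ne
  have hG : Filter.Tendsto (fun n : ℕ => ‖a ^ n‖ ^ (1 / n : ℝ)) Filter.atTop
      (nhds (spectralRadius ℂ a).toReal) := by
    refine ((ENNReal.tendsto_toReal hfin).comp
      (spectrum.pow_norm_pow_one_div_tendsto_nhds_spectralRadius a)).congr fun n => ?_
    exact ENNReal.toReal_ofReal (by positivity)
  have hlower : ∀ n : ℕ, 1 ≤ n → min 1 C₁⁻¹ * δ ≤ ‖a ^ n‖ ^ (1 / n : ℝ) := by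
    intro n hn
    have hn0 : (n : ℝ) ≠ 0 := by positivity
    have hm : 0 < min 1 C₁⁻¹ := lt_min one_pos (inv_pos.2 hC₁)
    have h1 : (min 1 C₁⁻¹ * δ) ^ n ≤ ‖a ^ n‖ := by
      have h2 : δ ^ n ≤ C₁ * ‖a ^ n‖ := (hlow n).trans (hup' n)
      rw [mul_pow]
      calc min 1 C₁⁻¹ ^ n * δ ^ n ≤ C₁⁻¹ * δ ^ n := by
            gcongr
            exact (pow_le_of_le_one hm.le (min_le_left _ _) (by omega)).trans (min_le_right _ _)
        _ ≤ ‖a ^ n‖ := by rwa [inv_mul_le_iff₀ hC₁]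
    calc min 1 C₁⁻¹ * δ = ((min 1 C₁⁻¹ * δ) ^ n) ^ (1 / n : ℝ) := by
          rw [← Real.rpow_natCast, ← Real.rpow_mul (by positivity), mul_one_div_cancel hn0,
            Real.rpow_one]
      _ ≤ _ := Real.rpow_le_rpow (by positivity) h1 (by positivity)
  have hrpos : 0 < (spectralRadius ℂ a).toReal := by
    refine lt_of_lt_of_le (mul_pos (lt_min one_pos (inv_pos.2 hC₁)) hδ) (ge_of_tendsto hG ?_)
    filter_upwards [Filter.eventually_ge_atTop 1] with n hn using hlower n hn
  have hlog : Filter.Tendsto (fun n : ℕ => Real.log ‖a ^ n‖ / n) Filter.atTop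
      (nhds (Real.log (spectralRadius ℂ a).toReal)) := by
    refine (hG.log hrpos.ne').congr fun n => ?_
    rw [Real.log_rpow (hapos n)]
    ring
  rw [hrad]
  refine tendsto_of_tendsto_of_tendsto_of_le_of_le'
    (Tendsto.shifted_add_div hlog (q + p) (-Real.log C₂))
    (Tendsto.shifted_add_div hlog q (Real.log C₁)) ?_ ?_
  · filter_upwards [Filter.eventually_ge_atTop (q + p)] with n hn
    obtain ⟨N, rfl⟩ := Nat.exists_eq_add_of_le hn
    rw [Nat.add_sub_cancel_left]
    have e : q + p + N = q + (N + p) := by ring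
    have h := Real.log_le_log (hapos N) (hdom' N)
    rw [Real.log_mul hC₂.ne' (hΓ _).ne', ← e] at h
    gcongr
    linarith
  · filter_upwards [Filter.eventually_ge_atTop q] with n hn
    obtain ⟨N, rfl⟩ := Nat.exists_eq_add_of_le hn
    rw [Nat.add_sub_cancel_left]
    have h := Real.log_le_log (hΓ N) (hup' N)
    rw [Real.log_mul hC₁.ne' (hapos _).ne'] at h
    gcongr
    linarith

theorem sum_cons_eq_sum {k m : ℕ} {R : Type*} [AddCommMonoid R] (f : (Fin (m + 1) → Fin k) → R) :
    ∑ a : Fin k, ∑ p : Fin m → Fin k, f (Fin.cons a p) = ∑ u, f u := by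
  rw [← Fintype.sum_prod_type', ← (Fin.consEquiv fun _ : Fin (m + 1) => Fin k).sum_comp]
  rfl

theorem sum_snoc_eq_sum {k m : ℕ} {R : Type*} [AddCommMonoid R] (f : (Fin (m + 1) → Fin k) → R) :
    ∑ w : Fin m → Fin k, ∑ j : Fin k, f (Fin.snoc w j) = ∑ u, f u := by
  rw [Finset.sum_comm, ← Fintype.sum_prod_type',
    ← (Fin.snocEquiv fun _ : Fin (m + 1) => Fin k).sum_comp]
  rfl

/-- Summing over the words with prescribed beginning `w` and end `p`, by first or by last letter. -/
theorem sum_ite_init_eq_sum_ite_tail {k m : ℕ} {R : Type*} [AddCommMonoid R]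
    (h : (Fin (m + 1) → Fin k) → R) (w p : Fin m → Fin k) :
    ∑ a : Fin k, (if Fin.init (Fin.cons a p : Fin (m + 1) → Fin k) = w
      then h (Fin.cons a p) else 0) =
    ∑ j : Fin k, (if p = Fin.tail (Fin.snoc w j : Fin (m + 1) → Fin k)
      then h (Fin.snoc w j) else 0) := by
  trans ∑ u, if Fin.init u = w ∧ p = Fin.tail u then h u else 0
  · rw [← sum_cons_eq_sum]
    refine Finset.sum_congr rfl fun a _ => ?_
    simp only [Fin.tail_cons, and_comm, ite_and, Finset.sum_ite_eq, Finset.mem_univ, if_true]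
  · rw [← sum_snoc_eq_sum]
    simp only [Fin.init_snoc, ite_and]
    rw [Finset.sum_comm]
    refine Finset.sum_congr rfl fun a _ => ?_
    simp

theorem prodRev_cons {d k n : ℕ} (V : Fin k → Matrix (Fin d) (Fin d) ℂ) (a : Fin k)
    (i : Fin n → Fin k) :
    prodRev V (Fin.cons a i : Fin (n + 1) → Fin k) = prodRev V i * V a := by
  simp [prodRev, List.ofFn_succ]

theorem sum_Mmat {d k : ℕ} (V : Fin k → Matrix (Fin d) (Fin d) ℂ)
    (hnorm : ∑ i : Fin k, (V i)ᴴ * V i = 1) (m : ℕ) :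
    ∑ w : Fin m → Fin k, Mmat V w = 1 := by
  induction m with
  | zero => simp [Mmat, prodRev]
  | succ m ih =>
    rw [← sum_cons_eq_sum, ← hnorm]
    refine Finset.sum_congr rfl fun a _ => ?_
    have h : ∀ p : Fin m → Fin k,
        Mmat V (Fin.cons a p : Fin (m + 1) → Fin k) = (V a)ᴴ * Mmat V p * V a := by
      intro p
      simp only [Mmat, prodRev_cons, conjTranspose_mul, Matrix.mul_assoc]
    simp only [h]
    rw [← Finset.sum_mul, ← Finset.mul_sum, ih, Matrix.mul_one]

/-- The total weight of the statistics `t` over the windows of length `m + 1` of a word. -/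
noncomputable def windowSum {k m N : ℕ} (t : (Fin (m + 1) → Fin k) → ℝ)
    (i : Fin (m + N) → Fin k) : ℝ :=
  ∑ j : Fin N, t (fun l : Fin (m + 1) => i ⟨j.1 + l.1, by have hj := j.2; have hl := l.2; omega⟩)

theorem windowSum_cons {k m N : ℕ} (t : (Fin (m + 1) → Fin k) → ℝ) (a : Fin k)
    (i : Fin (m + N) → Fin k) :
    windowSum (N := N + 1) t (Fin.cons a i : Fin (m + N + 1) → Fin k) =
      t (Fin.cons a (fun l => i (Fin.castAdd N l))) + windowSum t i := by
  unfold windowSum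
  rw [Fin.sum_univ_succ]
  congr 1
  · congr 1
    funext l
    refine Fin.cases ?_ (fun l => ?_) l
    · rfl
    · rw [Fin.cons_succ]
      have : (⟨(0 : Fin (N + 1)).1 + l.succ.1, by have := l.2; simp; omega⟩ : Fin (m + N + 1)) =
        Fin.succ (Fin.castAdd N l) := by ext; simp
      exact (congrArg (Fin.cons a i : Fin (m + N + 1) → Fin k) this).trans (Fin.cons_succ _ _ _)
  · refine Finset.sum_congr rfl fun j _ => ?_
    congr 1
    funext l
    have : (⟨j.succ.1 + l.1, by have := l.2; have := j.2; simp; omega⟩ : Fin (m + N + 1)) =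
        Fin.succ ⟨j.1 + l.1, by have := l.2; have := j.2; omega⟩ := by ext; simp; omega
    exact (congrArg (Fin.cons a i : Fin (m + N + 1) → Fin k) this).trans (Fin.cons_succ _ _ _)

/-- Iterating `T_{t,m}` on `M^{(m)}` sums over all words with a given beginning. -/
theorem extT_iterate_Mmat {d k m : ℕ} (V : Fin k → Matrix (Fin d) (Fin d) ℂ)
    (t : (Fin (m + 1) → Fin k) → ℝ) (N : ℕ) (w : Fin m → Fin k) :
    (extT V t)^[N] (Mmat V) w = ∑ i : Fin (m + N) → Fin k,
      if (fun l => i (Fin.castAdd N l)) = w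
        then (Real.exp (windowSum t i) : ℂ) • ((prodRev V i)ᴴ * prodRev V i) else 0 := by
  induction N generalizing w with
  | zero =>
    have : ∀ i : Fin (m + 0) → Fin k, (fun l => i (Fin.castAdd 0 l)) = i := fun i => rfl
    simp only [this]
    simp [windowSum, Mmat]
  | succ N ih =>
    rw [Function.iterate_succ_apply']
    have hRHS := sum_cons_eq_sum (m := m + N) (fun i : Fin (m + (N + 1)) → Fin k =>
      if (fun l => i (Fin.castAdd (N + 1) l)) = w
        then (Real.exp (windowSum t i) : ℂ) • ((prodRev V i)ᴴ * prodRev V i) else 0)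
    refine Eq.trans ?_ hRHS
    rw [Finset.sum_comm]
    simp only [extT, ih, Finset.mul_sum, Finset.sum_mul, Finset.smul_sum]
    rw [Finset.sum_comm]
    refine Finset.sum_congr rfl fun i _ => ?_
    set p : Fin m → Fin k := fun l => i (Fin.castAdd N l) with hp
    have hinit : ∀ a : Fin k, (fun l : Fin m => (Fin.cons a i : Fin (m + N + 1) → Fin k)
        (Fin.castAdd (N + 1) l)) = Fin.init (Fin.cons a p : Fin (m + 1) → Fin k) := by
      intro a
      funext l
      cases m with
      | zero => exact l.elim0
      | succ m =>
        refine Fin.cases ?_ (fun l => ?_) l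
        · rfl
        · simp only [Fin.init, hp]
          rw [Fin.castSucc_succ, Fin.cons_succ]
          have : (Fin.castAdd (N + 1) l.succ : Fin (m + 1 + N + 1)) =
            Fin.succ (Fin.castAdd N l.castSucc) := by ext; simp
          exact (congrArg (Fin.cons a i : Fin (m + 1 + N + 1) → Fin k) this).trans
            (Fin.cons_succ _ _ _)
    have key := sum_ite_init_eq_sum_ite_tail (fun u : Fin (m + 1) → Fin k =>
      (Real.exp (t u) : ℂ) • ((V (u 0))ᴴ *
        ((Real.exp (windowSum t i) : ℂ) • ((prodRev V i)ᴴ * prodRev V i)) * V (u 0))) w p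
    refine Eq.trans ?_ (key.symm.trans ?_)
    · refine Finset.sum_congr rfl fun j _ => ?_
      split_ifs <;> simp
    · refine Finset.sum_congr rfl fun a _ => ?_
      rw [hinit a, windowSum_cons, ← hp]
      have := prodRev_cons V a i
      congr 1
      refine Eq.trans ?_ (congrArg (fun P : Matrix (Fin d) (Fin d) ℂ =>
        ((Real.exp (t (Fin.cons a p) + windowSum t i) : ℝ) : ℂ) • (Pᴴ * P)) this).symm
      simp only [Fin.cons_zero, Real.exp_add, Complex.ofReal_mul, mul_smul, conjTranspose_mul,
        Matrix.mul_assoc, Matrix.mul_smul, Matrix.smul_mul]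

theorem mgf_eq_quadratic_form {d k m : ℕ} (V : Fin k → Matrix (Fin d) (Fin d) ℂ) (ψ : Fin d → ℂ)
    (t : (Fin (m + 1) → Fin k) → ℝ) (N : ℕ) :
    (mgf V ψ t (m + N) : ℂ) =
      star ψ ⬝ᵥ ((∑ w, (extT V t)^[N] (Mmat V) w) *ᵥ ψ) := by
  have h1 : ∑ w, (extT V t)^[N] (Mmat V) w = ∑ i : Fin (m + N) → Fin k,
      (Real.exp (windowSum t i) : ℂ) • ((prodRev V i)ᴴ * prodRev V i) := by
    simp only [extT_iterate_Mmat]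
    rw [Finset.sum_comm]
    simp
  rw [h1, Matrix.sum_mulVec, dotProduct_sum, mgf, Complex.ofReal_sum]
  refine Finset.sum_congr rfl fun i _ => ?_
  rw [Matrix.smul_mulVec, dotProduct_smul, smul_eq_mul, Complex.ofReal_mul, mul_comm]
  congr 1
  · congr 2
    exact Fintype.sum_equiv (finCongr (Nat.add_sub_cancel_left m N)) _ _ fun j => rfl
  · rw [← Matrix.mulVec_mulVec, Matrix.dotProduct_mulVec, ← Matrix.star_mulVec, outProb,
      Complex.ofReal_sum]
    refine Finset.sum_congr rfl fun x _ => ?_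
    rw [Pi.star_apply, Complex.star_def, ← Complex.normSq_eq_conj_mul_self,
      Complex.normSq_eq_norm_sq]

/-- The real part of the quadratic form `x ↦ x* A x` of a matrix. -/
noncomputable def quadRe {d : ℕ} (A : Matrix (Fin d) (Fin d) ℂ) (x : Fin d → ℂ) : ℝ :=
  (star x ⬝ᵥ A *ᵥ x).re

theorem quadRe_sum {d : ℕ} {ι : Type*} (s : Finset ι) (A : ι → Matrix (Fin d) (Fin d) ℂ)
    (x : Fin d → ℂ) : quadRe (∑ i ∈ s, A i) x = ∑ i ∈ s, quadRe (A i) x := by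
  simp only [quadRe, Matrix.sum_mulVec, dotProduct_sum, Complex.re_sum]

theorem quadRe_smul {d : ℕ} (c : ℝ) (A : Matrix (Fin d) (Fin d) ℂ) (x : Fin d → ℂ) :
    quadRe ((c : ℂ) • A) x = c * quadRe A x := by
  simp [quadRe, Matrix.smul_mulVec, dotProduct_smul]

theorem star_dotProduct_conj_mulVec {d : ℕ} (A B : Matrix (Fin d) (Fin d) ℂ) (x y : Fin d → ℂ) :
    star x ⬝ᵥ (Bᴴ * A * B) *ᵥ y = star (B *ᵥ x) ⬝ᵥ A *ᵥ (B *ᵥ y) := by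
  rw [Matrix.mul_assoc, ← Matrix.mulVec_mulVec, Matrix.dotProduct_mulVec, ← Matrix.star_mulVec,
    ← Matrix.mulVec_mulVec]

theorem quadRe_conj {d : ℕ} (A B : Matrix (Fin d) (Fin d) ℂ) (x : Fin d → ℂ) :
    quadRe (Bᴴ * A * B) x = quadRe A (B *ᵥ x) := by
  rw [quadRe, star_dotProduct_conj_mulVec, quadRe]

theorem quadRe_one {d : ℕ} (x : Fin d → ℂ) :
    quadRe 1 x = ∑ a, ‖x a‖ ^ 2 := by
  rw [quadRe, Matrix.one_mulVec, dotProduct, Complex.re_sum]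
  refine Finset.sum_congr rfl fun a _ => ?_
  rw [Pi.star_apply, Complex.star_def, ← Complex.normSq_eq_conj_mul_self,
    Complex.normSq_eq_norm_sq, Complex.ofReal_re]

theorem quadRe_nonneg {d : ℕ} {A : Matrix (Fin d) (Fin d) ℂ} (hA : A.PosSemidef) (x : Fin d → ℂ) :
    0 ≤ quadRe A x :=
  (Complex.le_def.1 (hA.dotProduct_mulVec_nonneg x)).1

theorem quadRe_add_le {d : ℕ} {A : Matrix (Fin d) (Fin d) ℂ} (hA : A.PosSemidef)
    (x y : Fin d → ℂ) : quadRe A (x + y) ≤ 2 * quadRe A x + 2 * quadRe A y := by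
  have h := quadRe_nonneg hA (x - y)
  simp only [quadRe, star_sub, star_add, Matrix.mulVec_sub, Matrix.mulVec_add, dotProduct_sub,
    dotProduct_add, sub_dotProduct, add_dotProduct, Complex.add_re, Complex.sub_re] at h ⊢
  linarith

theorem quadRe_smul_right {d : ℕ} (A : Matrix (Fin d) (Fin d) ℂ) (c : ℂ) (x : Fin d → ℂ) :
    quadRe A (c • x) = ‖c‖ ^ 2 * quadRe A x := by
  simp only [quadRe, star_smul, Matrix.mulVec_smul, dotProduct_smul, smul_dotProduct, smul_eq_mul,
    ← mul_assoc, Complex.star_def]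
  rw [mul_comm c, ← Complex.normSq_eq_conj_mul_self, Complex.normSq_eq_norm_sq,
    Complex.re_ofReal_mul]

theorem quadRe_Tmap {d k : ℕ} (V : Fin k → Matrix (Fin d) (Fin d) ℂ)
    (A : Matrix (Fin d) (Fin d) ℂ) (x : Fin d → ℂ) :
    quadRe (Tmap V A) x = ∑ i, quadRe A (V i *ᵥ x) := by
  simp only [Tmap, quadRe_sum, quadRe_conj]

theorem Tmap_posSemidef {d k : ℕ} (V : Fin k → Matrix (Fin d) (Fin d) ℂ)
    {A : Matrix (Fin d) (Fin d) ℂ} (hA : A.PosSemidef) : (Tmap V A).PosSemidef :=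
  Matrix.posSemidef_sum _ fun i _ => hA.conjTranspose_mul_mul_same (V i)

theorem Tmap_iterate_posSemidef {d k : ℕ} (V : Fin k → Matrix (Fin d) (Fin d) ℂ)
    {A : Matrix (Fin d) (Fin d) ℂ} (hA : A.PosSemidef) (p : ℕ) :
    ((Tmap V)^[p] A).PosSemidef := by
  induction p with
  | zero => exact hA
  | succ p ih => rw [Function.iterate_succ_apply']; exact Tmap_posSemidef V ih

/-- The vectors at which every positive semidefinite form is controlled by its image under `T^p`
evaluated at `x`. -/
noncomputable def controlledSubspace {d k : ℕ} (V : Fin k → Matrix (Fin d) (Fin d) ℂ) (p : ℕ)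
    (x : Fin d → ℂ) : Submodule ℂ (Fin d → ℂ) where
  carrier := {y | ∃ C : ℝ, 0 ≤ C ∧ ∀ A : Matrix (Fin d) (Fin d) ℂ, A.PosSemidef →
    quadRe A y ≤ C * quadRe ((Tmap V)^[p] A) x}
  add_mem' := by
    rintro y z ⟨C, hC, hy⟩ ⟨D, hD, hz⟩
    refine ⟨2 * C + 2 * D, by positivity, fun A hA => ?_⟩
    linarith [quadRe_add_le hA y z, hy A hA, hz A hA]
  zero_mem' := ⟨0, le_rfl, fun A _ => by simp [quadRe]⟩
  smul_mem' := by
    rintro c y ⟨C, hC, hy⟩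
    refine ⟨‖c‖ ^ 2 * C, by positivity, fun A hA => ?_⟩
    rw [quadRe_smul_right, mul_assoc]
    exact mul_le_mul_of_nonneg_left (hy A hA) (by positivity)

theorem controlledSubspace_mulVec_le {d k : ℕ} (V : Fin k → Matrix (Fin d) (Fin d) ℂ) (p : ℕ)
    (x : Fin d → ℂ) (j : Fin k) :
    controlledSubspace V p (V j *ᵥ x) ≤ controlledSubspace V (p + 1) x := by
  rintro y ⟨C, hC, hy⟩
  refine ⟨C, hC, fun A hA => (hy A hA).trans (mul_le_mul_of_nonneg_left ?_ hC)⟩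
  rw [Function.iterate_succ_apply', quadRe_Tmap]
  exact Finset.single_le_sum
    (f := fun i => quadRe ((Tmap V)^[p] A) (V i *ᵥ x))
    (fun i _ => quadRe_nonneg (Tmap_iterate_posSemidef V hA p) _) (Finset.mem_univ j)

theorem quadRe_Tmap_iterate_vecMulVec_eq_zero {d k : ℕ} (V : Fin k → Matrix (Fin d) (Fin d) ℂ)
    (p : ℕ) (x v : Fin d → ℂ) (h : ∀ y ∈ controlledSubspace V p x, star v ⬝ᵥ y = 0) :
    quadRe ((Tmap V)^[p] (vecMulVec v (star v))) x = 0 := by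
  induction p generalizing x with
  | zero =>
    have hx : x ∈ controlledSubspace V 0 x := ⟨1, zero_le_one, fun A _ => by simp⟩
    simp [quadRe, Matrix.vecMulVec_mulVec, h x hx]
  | succ p ih =>
    rw [Function.iterate_succ_apply', quadRe_Tmap]
    exact Finset.sum_eq_zero fun i _ =>
      ih _ fun y hy => h y (controlledSubspace_mulVec_le V p x i hy)

/-- Primitivity makes the form `A ↦ x* T^p(A) x` dominate evaluation at every vector. -/
theorem exists_quadRe_le_mul_quadRe_Tmap_iterate {d k : ℕ}
    (V : Fin k → Matrix (Fin d) (Fin d) ℂ) (p : ℕ)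
    (hp : ∀ A : Matrix (Fin d) (Fin d) ℂ, A.PosSemidef → A ≠ 0 → ((Tmap V)^[p] A).PosDef)
    {x : Fin d → ℂ} (hx : x ≠ 0) (y : Fin d → ℂ) :
    ∃ C : ℝ, 0 ≤ C ∧ ∀ A : Matrix (Fin d) (Fin d) ℂ, A.PosSemidef →
      quadRe A y ≤ C * quadRe ((Tmap V)^[p] A) x := by
  change y ∈ controlledSubspace V p x
  suffices h : controlledSubspace V p x = ⊤ by rw [h]; trivial
  by_contra h
  obtain ⟨f, hf, hle⟩ := Submodule.exists_le_ker_of_lt_top _ (lt_top_iff_ne_top.2 h)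
  set v : Fin d → ℂ := fun a => star (f (Pi.single a 1)) with hv
  have hfv : ∀ z, star v ⬝ᵥ z = f z := by
    intro z
    rw [LinearMap.pi_apply_eq_sum_univ f z]
    refine Finset.sum_congr rfl fun a _ => ?_
    have e : (fun j => if a = j then (1 : ℂ) else 0) = Pi.single a 1 := by
      ext j; simp [Pi.single_apply, eq_comm]
    simp [hv, e, mul_comm]
  have hv0 : v ≠ 0 := by
    intro h0
    exact hf (LinearMap.ext fun z => by rw [← hfv, h0]; simp)
  have hzero := quadRe_Tmap_iterate_vecMulVec_eq_zero V p x v fun y hy => by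
    rw [hfv]; exact hle hy
  have hA0 : vecMulVec v (star v) ≠ 0 := by
    intro h0
    refine hv0 (funext fun a => ?_)
    have := congrFun (congrFun h0 a) a
    simpa [vecMulVec_apply] using this
  have hpd := (hp _ (posSemidef_vecMulVec_self_star v) hA0).dotProduct_mulVec_pos hx
  exact absurd hzero (Complex.lt_def.1 hpd).1.ne'

theorem extT_posSemidef {d k m : ℕ} (V : Fin k → Matrix (Fin d) (Fin d) ℂ)
    (t : (Fin (m + 1) → Fin k) → ℝ) {Y : (Fin m → Fin k) → Matrix (Fin d) (Fin d) ℂ}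
    (hY : ∀ w, (Y w).PosSemidef) (w : Fin m → Fin k) : (extT V t Y w).PosSemidef :=
  Matrix.posSemidef_sum _ fun j _ => ((hY _).conjTranspose_mul_mul_same _).smul
    (by exact_mod_cast (Real.exp_pos _).le)

theorem extT_iterate_posSemidef {d k m : ℕ} (V : Fin k → Matrix (Fin d) (Fin d) ℂ)
    (t : (Fin (m + 1) → Fin k) → ℝ) {Y : (Fin m → Fin k) → Matrix (Fin d) (Fin d) ℂ}
    (hY : ∀ w, (Y w).PosSemidef) (N : ℕ) (w : Fin m → Fin k) :
    ((extT V t)^[N] Y w).PosSemidef := by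
  induction N generalizing w with
  | zero => exact hY w
  | succ N ih => rw [Function.iterate_succ_apply']; exact extT_posSemidef V t ih w

theorem mul_quadRe_Tmap_sum_le_quadRe_sum_extT {d k m : ℕ}
    (V : Fin k → Matrix (Fin d) (Fin d) ℂ) (t : (Fin (m + 1) → Fin k) → ℝ) {δ : ℝ}
    (hδ : ∀ u, δ ≤ Real.exp (t u)) {Y : (Fin m → Fin k) → Matrix (Fin d) (Fin d) ℂ}
    (hY : ∀ w, (Y w).PosSemidef) (x : Fin d → ℂ) :
    δ * quadRe (Tmap V (∑ w, Y w)) x ≤ quadRe (∑ w, extT V t Y w) x := by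
  have h := sum_snoc_eq_sum (m := m) fun u : Fin (m + 1) → Fin k =>
    Real.exp (t u) * quadRe (Y (Fin.tail u)) (V (u 0) *ᵥ x)
  simp only [extT, quadRe_sum, quadRe_smul, quadRe_conj, quadRe_Tmap, Finset.mul_sum]
  rw [h, ← sum_cons_eq_sum]
  refine Finset.sum_le_sum fun a _ => Finset.sum_le_sum fun p _ => ?_
  rw [Fin.tail_cons, Fin.cons_zero]
  exact mul_le_mul_of_nonneg_right (hδ _) (quadRe_nonneg (hY p) _)

theorem pow_mul_quadRe_Tmap_iterate_sum_le {d k m : ℕ}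
    (V : Fin k → Matrix (Fin d) (Fin d) ℂ) (t : (Fin (m + 1) → Fin k) → ℝ) {δ : ℝ} (hδ0 : 0 ≤ δ)
    (hδ : ∀ u, δ ≤ Real.exp (t u)) {Y : (Fin m → Fin k) → Matrix (Fin d) (Fin d) ℂ}
    (hY : ∀ w, (Y w).PosSemidef) (p : ℕ) (x : Fin d → ℂ) :
    δ ^ p * quadRe ((Tmap V)^[p] (∑ w, Y w)) x ≤ quadRe (∑ w, (extT V t)^[p] Y w) x := by
  induction p generalizing x with
  | zero => simp
  | succ p ih =>
    simp only [Function.iterate_succ_apply']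
    refine le_trans ?_ (mul_quadRe_Tmap_sum_le_quadRe_sum_extT V t hδ
      (fun w => extT_iterate_posSemidef V t hY p w) x)
    rw [pow_succ', mul_assoc]
    refine mul_le_mul_of_nonneg_left ?_ hδ0
    simp only [quadRe_Tmap, Finset.mul_sum]
    exact Finset.sum_le_sum fun i _ => ih _

theorem extT_iterate_dominated {d k m : ℕ} (V : Fin k → Matrix (Fin d) (Fin d) ℂ)
    (t : (Fin (m + 1) → Fin k) → ℝ) {C : ℝ}
    {Y Z : (Fin m → Fin k) → Matrix (Fin d) (Fin d) ℂ}
    (h : ∀ w x y, ‖star x ⬝ᵥ Y w *ᵥ y‖ ≤ C * (quadRe (Z w) x + quadRe (Z w) y)) (N : ℕ)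
    (w : Fin m → Fin k) (x y : Fin d → ℂ) :
    ‖star x ⬝ᵥ (extT V t)^[N] Y w *ᵥ y‖ ≤
      C * (quadRe ((extT V t)^[N] Z w) x + quadRe ((extT V t)^[N] Z w) y) := by
  induction N generalizing w x y with
  | zero => exact h w x y
  | succ N ih =>
    simp only [Function.iterate_succ_apply']
    simp only [extT, quadRe_sum, quadRe_smul, quadRe_conj, Matrix.sum_mulVec, dotProduct_sum,
      ← Finset.sum_add_distrib, Finset.mul_sum]
    refine (norm_sum_le _ _).trans (Finset.sum_le_sum fun j _ => ?_)
    rw [Matrix.smul_mulVec, dotProduct_smul, star_dotProduct_conj_mulVec, smul_eq_mul, norm_mul,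
      Complex.norm_real, Real.norm_eq_abs, abs_of_pos (Real.exp_pos _), ← mul_add, mul_left_comm]
    exact mul_le_mul_of_nonneg_left (ih _ _ _) (Real.exp_pos _).le

theorem norm_star_dotProduct_mulVec_le {d : ℕ} (K : Matrix (Fin d) (Fin d) ℂ) :
    ∃ C : ℝ, 0 ≤ C ∧ ∀ x y : Fin d → ℂ,
      ‖star x ⬝ᵥ K *ᵥ y‖ ≤ C * (quadRe 1 x + quadRe 1 y) := by
  refine ⟨∑ a, ∑ b, ‖K a b‖, by positivity, fun x y => ?_⟩
  simp only [dotProduct, mulVec, Finset.mul_sum, Finset.sum_mul]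
  refine (norm_sum_le _ _).trans (Finset.sum_le_sum fun a _ => (norm_sum_le _ _).trans
    (Finset.sum_le_sum fun b _ => ?_))
  have hx : ‖x a‖ ^ 2 ≤ quadRe 1 x := by
    rw [quadRe_one]
    exact Finset.single_le_sum (f := fun a => ‖x a‖ ^ 2) (fun _ _ => by positivity)
      (Finset.mem_univ a)
  have hy : ‖y b‖ ^ 2 ≤ quadRe 1 y := by
    rw [quadRe_one]
    exact Finset.single_le_sum (f := fun a => ‖y a‖ ^ 2) (fun _ _ => by positivity)
      (Finset.mem_univ b)
  rw [norm_mul, norm_mul, Pi.star_apply, norm_star, mul_left_comm]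
  refine mul_le_mul_of_nonneg_left ?_ (norm_nonneg _)
  nlinarith [sq_nonneg (‖x a‖ - ‖y b‖), sq_nonneg ‖x a‖, sq_nonneg ‖y b‖]

theorem exists_mul_eq_of_ker_le {d : ℕ} (P Q : Matrix (Fin d) (Fin d) ℂ)
    (h : ∀ v, P *ᵥ v = 0 → Q *ᵥ v = 0) : ∃ L : Matrix (Fin d) (Fin d) ℂ, L * P = Q := by
  have hker : LinearMap.ker (Matrix.toLin' P) ≤ LinearMap.ker (Matrix.toLin' Q) := by
    intro v hv
    simpa using h v (by simpa using hv)
  obtain ⟨g, hg⟩ := LinearMap.exists_extend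
    ((LinearMap.ker (Matrix.toLin' P)).liftQ (Matrix.toLin' Q) hker ∘ₗ
      (Matrix.toLin' P).quotKerEquivRange.symm.toLinearMap)
  refine ⟨LinearMap.toMatrix' g, Matrix.toLin'.injective (LinearMap.ext fun v => ?_)⟩
  have h2 := LinearMap.congr_fun hg ⟨Matrix.toLin' P v, LinearMap.mem_range_self _ v⟩
  rw [Matrix.toLin'_mul, Matrix.toLin'_toMatrix']
  refine h2.trans ?_
  have : (Matrix.toLin' P).quotKerEquivRange.symm ⟨Matrix.toLin' P v, LinearMap.mem_range_self _ v⟩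
      = Submodule.Quotient.mk v := by
    rw [LinearEquiv.symm_apply_eq]
    rfl
  simp only [LinearMap.comp_apply, LinearEquiv.coe_coe, this]
  exact Submodule.liftQ_apply _ _ _

/-- Elements of `B_m` are dominated by multiples of `M^{(m)}`. -/
theorem exists_dominated_Mmat {d k m : ℕ} (V : Fin k → Matrix (Fin d) (Fin d) ℂ)
    {Q : (Fin m → Fin k) → Matrix (Fin d) (Fin d) ℂ} (hQherm : ∀ w, (Q w).IsHermitian)
    (hQker : ∀ w (v : Fin d → ℂ), Mmat V w *ᵥ v = 0 → Q w *ᵥ v = 0)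
    {Y : (Fin m → Fin k) → Matrix (Fin d) (Fin d) ℂ} (hY : Y ∈ Bsub Q) :
    ∃ C : ℝ, 0 ≤ C ∧ ∀ w x y,
      ‖star x ⬝ᵥ Y w *ᵥ y‖ ≤ C * (quadRe (Mmat V w) x + quadRe (Mmat V w) y) := by
  have hM : ∀ w : Fin m → Fin k, Mmat V w = (prodRev V w)ᴴ * 1 * prodRev V w := fun w => by simp [Mmat]
  have hw : ∀ w, ∃ C : ℝ, 0 ≤ C ∧ ∀ x y,
      ‖star x ⬝ᵥ Y w *ᵥ y‖ ≤ C * (quadRe (Mmat V w) x + quadRe (Mmat V w) y) := by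
    intro w
    obtain ⟨L, hL⟩ := exists_mul_eq_of_ker_le (prodRev V w) (Q w) fun v hv => hQker w v (by
      rw [Mmat, ← Matrix.mulVec_mulVec, hv, Matrix.mulVec_zero])
    obtain ⟨C, hC, h⟩ := norm_star_dotProduct_mulVec_le (Lᴴ * Y w * L)
    have hYw : Y w = (prodRev V w)ᴴ * (Lᴴ * Y w * L) * prodRev V w := by
      calc Y w = (Q w)ᴴ * Y w * Q w := by rw [(hQherm w).eq]; exact hY w
        _ = _ := by rw [← hL, Matrix.conjTranspose_mul]; simp only [Matrix.mul_assoc]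
    refine ⟨C, hC, fun x y => ?_⟩
    rw [hYw, hM, star_dotProduct_conj_mulVec, quadRe_conj, quadRe_conj]
    exact h _ _
  choose C hC h using hw
  refine ⟨∑ w, C w, Finset.sum_nonneg fun w _ => hC w, fun w x y => (h w x y).trans ?_⟩
  have hpsd : (Mmat V w).PosSemidef := Matrix.posSemidef_conjTranspose_mul_self _
  exact mul_le_mul_of_nonneg_right
    (Finset.single_le_sum (fun w _ => hC w) (Finset.mem_univ w))
    (add_nonneg (quadRe_nonneg hpsd x) (quadRe_nonneg hpsd y))

theorem Mmat_mem_Bsub {d k m : ℕ} (V : Fin k → Matrix (Fin d) (Fin d) ℂ)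
    {Q : (Fin m → Fin k) → Matrix (Fin d) (Fin d) ℂ} (hQherm : ∀ w, (Q w).IsHermitian)
    (hQrange : ∀ w, Q w * Mmat V w = Mmat V w) : Mmat V ∈ Bsub Q := by
  intro w
  have h := congrArg Matrix.conjTranspose (hQrange w)
  have hM : (Mmat V w)ᴴ = Mmat V w := (Matrix.posSemidef_conjTranspose_mul_self _).1
  rw [Matrix.conjTranspose_mul, (hQherm w).eq, hM] at h
  rw [hQrange, h]

theorem Tmap_iterate_one {d k : ℕ} (V : Fin k → Matrix (Fin d) (Fin d) ℂ)
    (hnorm : ∑ i : Fin k, (V i)ᴴ * V i = 1) (p : ℕ) : (Tmap V)^[p] 1 = 1 :=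
  Function.iterate_fixed (by simpa [Tmap] using hnorm) p

/-- The limit of `n⁻¹ log Γₙ⁽ᵐ⁾(t)` is `log r(T̃_{t,m})`, where `T̃_{t,m}` is the restriction
of the extended transition operator `T_{t,m}` to the invariant subspace `B_m`, and `r` denotes
its spectral radius. -/
theorem limit_log_mgf {d k m' : ℕ} (hd : 1 ≤ d) (hk : 1 ≤ k)
    (V : Fin k → Matrix (Fin d) (Fin d) ℂ)
    (hnorm : ∑ i : Fin k, (V i)ᴴ * V i = 1)
    -- the transition operator is primitive
    (hprim : ∃ n : ℕ, ∀ A : Matrix (Fin d) (Fin d) ℂ,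
      A.PosSemidef → A ≠ 0 → ((Tmap V)^[n] A).PosDef)
    -- `ψ` is a unit vector
    (ψ : Fin d → ℂ) (hψ : ∑ x : Fin d, ‖ψ x‖ ^ 2 = 1)
    -- `Q_w` is the orthogonal projection onto the range of `[M^{(m)}]_w`
    (Q : (Fin m' → Fin k) → Matrix (Fin d) (Fin d) ℂ)
    (hQherm : ∀ w, (Q w).IsHermitian)
    (hQidem : ∀ w, Q w * Q w = Q w)
    (hQrange : ∀ w, Q w * Mmat V w = Mmat V w)
    (hQker : ∀ w (v : Fin d → ℂ), Mmat V w *ᵥ v = 0 → Q w *ᵥ v = 0)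
    (t : (Fin (m' + 1) → Fin k) → ℝ)
    -- `S` is the restriction `T̃_{t,m}` of `T_{t,m}` to `B_m`
    (S : Module.End ℂ ↥(Bsub Q))
    (hS : ∀ Y : ↥(Bsub Q), ((S Y : (Fin m' → Fin k) → Matrix (Fin d) (Fin d) ℂ))
      = extT V t (Y : (Fin m' → Fin k) → Matrix (Fin d) (Fin d) ℂ)) :
    Filter.Tendsto (fun n : ℕ => Real.log (mgf V ψ t n) / n) Filter.atTop
      (nhds (Real.log ((spectralRadius ℂ S).toReal))) := by
  have hψ0 : ψ ≠ 0 := by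
    rintro rfl
    simp at hψ
  obtain ⟨p, hp⟩ := hprim
  have hMpsd : ∀ w, (Mmat V w : Matrix (Fin d) (Fin d) ℂ).PosSemidef :=
    fun w : Fin m' → Fin k => Matrix.posSemidef_conjTranspose_mul_self _
  have hGpsd := extT_iterate_posSemidef V t hMpsd
  set δ : ℝ := Real.exp (-∑ u, |t u|) with hδdef
  have hδ0 : 0 < δ := Real.exp_pos _
  have hδ : ∀ u, δ ≤ Real.exp (t u) := fun u => Real.exp_le_exp.2 <| by
    have := Finset.single_le_sum (f := fun u => |t u|) (fun _ _ => abs_nonneg _)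
      (Finset.mem_univ u)
    linarith [neg_abs_le (t u)]
  have hmgf : ∀ N, mgf V ψ t (m' + N) = quadRe (∑ w, (extT V t)^[N] (Mmat V) w) ψ := fun N => by
    rw [quadRe, ← mgf_eq_quadratic_form, Complex.ofReal_re]
  have hSpow : ∀ N (Y : ↥(Bsub Q)),
      ((S ^ N) Y : (Fin m' → Fin k) → Matrix (Fin d) (Fin d) ℂ) = (extT V t)^[N] Y := by
    intro N Y
    induction N with
    | zero => rfl
    | succ N ih => rw [pow_succ', Module.End.mul_apply, hS, ih, Function.iterate_succ_apply']
  let _ : NormedAddCommGroup (Matrix (Fin d) (Fin d) ℂ) := Matrix.normedAddCommGroup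
  let _ : NormedSpace ℂ (Matrix (Fin d) (Fin d) ℂ) := Matrix.normedSpace
  let φ : ↥(Bsub Q) →ₗ[ℂ] ℂ :=
    { toFun := fun Y => star ψ ⬝ᵥ (∑ w, Y.1 w) *ᵥ ψ
      map_add' := fun Y Z => by
        simp [Finset.sum_add_distrib, Matrix.add_mulVec]
      map_smul' := fun c Y => by
        simp [← Finset.smul_sum, Matrix.smul_mulVec] }
  refine tendsto_log_div_of_comparable_pow S (mgf V ψ t) m' p hδ0 (fun N => ?_) φ
    ⟨Mmat V, Mmat_mem_Bsub V hQherm hQrange⟩ (fun N => ?_) (fun Y => ?_)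
  · have h := pow_mul_quadRe_Tmap_iterate_sum_le V t hδ0.le hδ hMpsd N ψ
    rwa [sum_Mmat V hnorm, Tmap_iterate_one V hnorm, quadRe_one, hψ, mul_one, ← hmgf] at h
  · have h : φ ((S ^ N) ⟨Mmat V, Mmat_mem_Bsub V hQherm hQrange⟩) = (mgf V ψ t (m' + N) : ℂ) := by
      rw [mgf_eq_quadratic_form]
      simp only [φ, LinearMap.coe_mk, AddHom.coe_mk, hSpow]
    rw [h, Complex.norm_real]
    exact le_abs_self _
  · obtain ⟨C, hC, hdom⟩ := exists_dominated_Mmat V hQherm hQker Y.2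
    choose D hD hDle using fun a : Fin d =>
      exists_quadRe_le_mul_quadRe_Tmap_iterate V p hp hψ0 (Pi.single a 1)
    have hDsum : 0 ≤ ∑ a, D a := Finset.sum_nonneg fun a _ => hD a
    have hentry : ∀ N w a, quadRe ((extT V t)^[N] (Mmat V) w) (Pi.single a 1) ≤
        (∑ a, D a) * ((δ ^ p)⁻¹ * mgf V ψ t (m' + (N + p))) := by
      intro N w a
      have hsum : (∑ w, (extT V t)^[N] (Mmat V) w).PosSemidef :=
        Matrix.posSemidef_sum _ fun w _ => hGpsd N w
      have h1 : quadRe ((extT V t)^[N] (Mmat V) w) (Pi.single a 1) ≤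
          quadRe (∑ w, (extT V t)^[N] (Mmat V) w) (Pi.single a 1) := by
        rw [quadRe_sum]
        exact Finset.single_le_sum
          (f := fun w => quadRe ((extT V t)^[N] (Mmat V) w) (Pi.single a 1))
          (fun w _ => quadRe_nonneg (hGpsd N w) _) (Finset.mem_univ w)
      have h2 := pow_mul_quadRe_Tmap_iterate_sum_le V t hδ0.le hδ (hGpsd N) p ψ
      simp only [← Function.iterate_add_apply] at h2
      rw [add_comm p N, ← hmgf, ← le_inv_mul_iff₀ (pow_pos hδ0 p)] at h2
      have hDa : D a ≤ ∑ a, D a := Finset.single_le_sum (fun a _ => hD a) (Finset.mem_univ a)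
      calc _ ≤ _ := h1
        _ ≤ D a * _ := hDle a _ hsum
        _ ≤ _ := mul_le_mul hDa h2 (quadRe_nonneg (Tmap_iterate_posSemidef V hsum p) ψ) hDsum
    refine ⟨C * (2 * ((∑ a, D a) * (δ ^ p)⁻¹)), fun N => ?_⟩
    have hnonneg : 0 ≤ mgf V ψ t (m' + (N + p)) := by
      rw [hmgf]
      exact quadRe_nonneg (Matrix.posSemidef_sum _ fun w _ => hGpsd _ w) ψ
    have hbound : 0 ≤ C * (2 * ((∑ a, D a) * (δ ^ p)⁻¹)) * mgf V ψ t (m' + (N + p)) := by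
      positivity
    rw [Submodule.coe_norm, hSpow, pi_norm_le_iff_of_nonneg hbound]
    intro w
    rw [Matrix.norm_le_iff hbound]
    intro a b
    have h := extT_iterate_dominated V t hdom N w (Pi.single a 1) (Pi.single b 1)
    rw [← Pi.single_star, star_one, Matrix.mulVec_single_one, single_one_dotProduct] at h
    refine (show ‖(extT V t)^[N] Y.1 w a b‖ ≤ _ from h).trans ?_
    have ha := hentry N w a
    have hb := hentry N w b
    calc C * _ ≤ C * ((∑ a, D a) * ((δ ^ p)⁻¹ * mgf V ψ t (m' + (N + p))) +
          (∑ a, D a) * ((δ ^ p)⁻¹ * mgf V ψ t (m' + (N + p)))) := by gcongr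
      _ = _ := by ring
end
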